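/- Let ρ, T, s, e_ρ : ℝ³ → ℝ be smooth with ρ(x) > 0 and T(x) > 0 for all x, let τ : ℝ³ → M₃(ℝ) be smooth with τ(x) symmetric for every x, let K : ℝ³ → M₃(ℝ) be smooth, let e_v : ℝ³ → ℝ³ be smooth and compactly supported, assume grad T is compactly supported, and set e_s := ρT and ω := curl(e_v/ρ). Then the total power ⟨e, J e⟩ vanishes: ∫_{ℝ³} [ e_ρ (−div e_v) + e_v · ( −grad e_ρ − (1/ρ)(ω × e_v) + (grad s)(e_s/ρ) − (1/ρ) Div( (e_s/(ρT)) τ ) ) + e_s ( −(grad s)·(e_v/ρ) − (1/(ρT)) τ : Grad(e_v/ρ) + (1/(ρT)) ( grad(e_s/ρ) · (K/T) grad(e_s/ρ) ) + (1/ρ) div( (K/T) grad(e_s/ρ) ) ) ] dx = 0. -/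

import Mathlib

open MeasureTheory Matrix

noncomputable section

/-- Points of ℝ³. -/
abbrev R3 : Type := Fin 3 → ℝ

/-- Partial derivative `∂f/∂xᵢ` of a scalar field. -/
def pd (i : Fin 3) (f : R3 → ℝ) (x : R3) : ℝ := fderiv ℝ f x (Pi.single i 1)

/-- Gradient of a scalar field. -/
def grad (f : R3 → ℝ) (x : R3) : R3 := fun i => pd i f x

/-- Divergence of a vector field. -/
def vdiv (u : R3 → R3) (x : R3) : ℝ := ∑ i, pd i (fun y => u y i) x

/-- Jacobian matrix `(Grad u)ᵢⱼ = ∂uᵢ/∂xⱼ` of a vector field. -/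
def vGrad (u : R3 → R3) (x : R3) : Matrix (Fin 3) (Fin 3) ℝ :=
  Matrix.of fun i j => pd j (fun y => u y i) x

/-- Divergence `(Div A)ⱼ = ∑ᵢ ∂Aᵢⱼ/∂xᵢ` of a matrix field. -/
def mDiv (A : R3 → Matrix (Fin 3) (Fin 3) ℝ) (x : R3) : R3 :=
  fun j => ∑ i, pd i (fun y => A y i j) x

/-- Frobenius inner product `A : B = ∑ᵢⱼ Aᵢⱼ Bᵢⱼ`. -/
def frob (A B : Matrix (Fin 3) (Fin 3) ℝ) : ℝ := ∑ i, ∑ j, A i j * B i j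

/-- Curl of a vector field. -/
def curl (u : R3 → R3) (x : R3) : R3 :=
  ![pd 1 (fun y => u y 2) x - pd 2 (fun y => u y 1) x,
    pd 2 (fun y => u y 0) x - pd 0 (fun y => u y 2) x,
    pd 0 (fun y => u y 1) x - pd 1 (fun y => u y 0) x]

/-- Cross product on ℝ³. -/
def cross (u v : R3) : R3 :=
  ![u 1 * v 2 - u 2 * v 1, u 2 * v 0 - u 0 * v 2, u 0 * v 1 - u 1 * v 0]

lemma contDiff_pd {f : R3 → ℝ} (hf : ContDiff ℝ (⊤ : ℕ∞) f) (i : Fin 3) :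
    ContDiff ℝ (⊤ : ℕ∞) (pd i f) :=
  (hf.fderiv_right (m := (⊤ : ℕ∞)) (by simp)).clm_apply contDiff_const

lemma pd_sub {f g : R3 → ℝ} {x : R3} (i : Fin 3) (hf : DifferentiableAt ℝ f x)
    (hg : DifferentiableAt ℝ g x) : pd i (fun y => f y - g y) x = pd i f x - pd i g x := by
  simp [pd, fderiv_fun_sub hf hg]

lemma pd_mul {f g : R3 → ℝ} {x : R3} (i : Fin 3) (hf : DifferentiableAt ℝ f x)
    (hg : DifferentiableAt ℝ g x) :
    pd i (fun y => f y * g y) x = f x * pd i g x + g x * pd i f x := by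
  simp [pd, fderiv_fun_mul hf hg]

lemma pd_sum {f : Fin 3 → R3 → ℝ} {x : R3} (i : Fin 3)
    (hf : ∀ j, DifferentiableAt ℝ (f j) x) :
    pd i (fun y => ∑ j, f j y) x = ∑ j, pd i (f j) x := by
  simp [pd, fderiv_fun_sum fun j _ => hf j]

lemma integrable_pd {f : R3 → ℝ} (hf : ContDiff ℝ (⊤ : ℕ∞) f) (hfs : HasCompactSupport f)
    (i : Fin 3) : Integrable (pd i f) :=
  (contDiff_pd hf i).continuous.integrable_of_hasCompactSupport
    (hfs.fderiv_apply (𝕜 := ℝ) (Pi.single i 1))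

lemma integral_pd_eq_zero {f : R3 → ℝ} (hf : ContDiff ℝ (⊤ : ℕ∞) f)
    (hfs : HasCompactSupport f) (i : Fin 3) : ∫ x, pd i f x = 0 := by
  have h := integral_mul_fderiv_eq_neg_fderiv_mul_of_integrable (μ := (volume : Measure R3))
    (f := fun _ : R3 => (1 : ℝ)) (g := f) (v := Pi.single i 1) (by simp)
    (by simpa [pd] using (integrable_pd hf hfs i : Integrable fun x => pd i f x))
    (by simpa using hf.continuous.integrable_of_hasCompactSupport hfs)
    (fun _ _ => differentiableAt_const _)
    (fun x _ => hf.differentiable (by simp) x)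
  simpa [pd] using h

/-- The divergence theorem for smooth compactly supported vector fields. -/
lemma integral_vdiv_eq_zero {F : R3 → R3} (hF : ∀ i, ContDiff ℝ (⊤ : ℕ∞) fun x => F x i)
    (hFs : ∀ i, HasCompactSupport fun x => F x i) : ∫ x, vdiv F x = 0 := by
  simp only [vdiv]
  rw [integral_finsetSum (f := fun i x => pd i (fun y => F y i) x) _
    fun i _ => integrable_pd (hF i) (hFs i) i]
  exact Finset.sum_eq_zero fun i _ => integral_pd_eq_zero (hF i) (hFs i) i

lemma dotProduct_cross_self (u v : R3) : v ⬝ᵥ cross u v = 0 := by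
  simp [dotProduct, cross, Fin.sum_univ_three]
  ring

lemma vdiv_smul {f : R3 → ℝ} {u : R3 → R3} {x : R3} (hf : DifferentiableAt ℝ f x)
    (hu : ∀ i, DifferentiableAt ℝ (fun y => u y i) x) :
    vdiv (fun y => f y • u y) x = f x * vdiv u x + u x ⬝ᵥ grad f x := by
  simp only [vdiv, Pi.smul_apply, smul_eq_mul, dotProduct, grad, Finset.mul_sum,
    ← Finset.sum_add_distrib]
  exact Finset.sum_congr rfl fun i _ => pd_mul i hf (hu i)

lemma vdiv_mulVec {A : R3 → Matrix (Fin 3) (Fin 3) ℝ} {u : R3 → R3} {x : R3}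
    (hA : ∀ i j, DifferentiableAt ℝ (fun y => A y i j) x)
    (hu : ∀ i, DifferentiableAt ℝ (fun y => u y i) x) :
    vdiv (fun y => A y *ᵥ u y) x = u x ⬝ᵥ mDiv A x + frob (A x)ᵀ (vGrad u x) := by
  have h (i : Fin 3) : pd i (fun y => (A y *ᵥ u y) i) x
      = ∑ j, (A x i j * pd i (fun y => u y j) x + u x j * pd i (fun y => A y i j) x) := by
    refine (pd_sum (f := fun j y => A y i j * u y j) i fun j => (hA i j).mul (hu j)).trans ?_
    exact Finset.sum_congr rfl fun j _ => pd_mul i (hA i j) (hu j)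
  simp only [vdiv, h, mDiv, frob, vGrad, dotProduct, Matrix.of_apply, transpose_apply,
    Fin.sum_univ_three]
  ring

lemma vdiv_sub {u v : R3 → R3} {x : R3} (hu : ∀ i, DifferentiableAt ℝ (fun y => u y i) x)
    (hv : ∀ i, DifferentiableAt ℝ (fun y => v y i) x) :
    vdiv (fun y => u y - v y) x = vdiv u x - vdiv v x := by
  simp only [vdiv, Pi.sub_apply, ← Finset.sum_sub_distrib]
  exact Finset.sum_congr rfl fun i _ => pd_sub i (hu i) (hv i)

lemma contDiff_mulVec {A : R3 → Matrix (Fin 3) (Fin 3) ℝ} {u : R3 → R3}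
    (hA : ∀ i j, ContDiff ℝ (⊤ : ℕ∞) fun x => A x i j)
    (hu : ∀ i, ContDiff ℝ (⊤ : ℕ∞) fun x => u x i) (i : Fin 3) :
    ContDiff ℝ (⊤ : ℕ∞) fun x => (A x *ᵥ u x) i := by
  simp only [mulVec, dotProduct]
  exact ContDiff.sum fun j _ => (hA i j).mul (hu j)

/-- Power balance of Proposition 1 of the paper (vanishing boundary conditions):
the total power `⟨e, J e⟩` of the pseudo port-Hamiltonian formulation of a
non-isentropic Newtonian fluid vanishes. Here `e_s = ρT` and `ω = curl(e_v/ρ)`. -/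
theorem stmt4 (ρ T s e_ρ : R3 → ℝ) (e_v : R3 → R3)
    (τ K : R3 → Matrix (Fin 3) (Fin 3) ℝ)
    (hρ : ContDiff ℝ (⊤ : ℕ∞) ρ) (hT : ContDiff ℝ (⊤ : ℕ∞) T) (hs : ContDiff ℝ (⊤ : ℕ∞) s)
    (heρ : ContDiff ℝ (⊤ : ℕ∞) e_ρ)
    (hρpos : ∀ x, 0 < ρ x) (hTpos : ∀ x, 0 < T x)
    (hτ : ∀ i j, ContDiff ℝ (⊤ : ℕ∞) fun x => τ x i j)
    (hτsym : ∀ x, (τ x).IsSymm)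
    (hK : ∀ i j, ContDiff ℝ (⊤ : ℕ∞) fun x => K x i j)
    (hev : ContDiff ℝ (⊤ : ℕ∞) e_v) (hevsupp : HasCompactSupport e_v)
    (hgradT : HasCompactSupport (grad T))
    (e_s : R3 → ℝ) (he_s : ∀ x, e_s x = ρ x * T x)
    (ω : R3 → R3) (hω : ∀ x, ω x = curl (fun y => (ρ y)⁻¹ • e_v y) x) :
    ∫ x,
      (e_ρ x * (- vdiv e_v x)
      + e_v x ⬝ᵥ (fun i =>
          - grad e_ρ x i
          - (1 / ρ x) * cross (ω x) (e_v x) i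
          + grad s x i * (e_s x / ρ x)
          - (1 / ρ x) * mDiv (fun y => (e_s y / (ρ y * T y)) • τ y) x i)
      + e_s x * (
          - (grad s x ⬝ᵥ (fun i => e_v x i / ρ x))
          - (1 / (ρ x * T x)) * frob (τ x) (vGrad (fun y i => e_v y i / ρ y) x)
          + (1 / (ρ x * T x)) *
              (grad (fun y => e_s y / ρ y) x ⬝ᵥ (((1 / T x) • K x) *ᵥ grad (fun y => e_s y / ρ y) x))
          + (1 / ρ x) * vdiv (fun y => ((1 / T y) • K y) *ᵥ grad (fun z => e_s z / ρ z) y) x)) = 0 := by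
  have hTs (x : R3) : e_s x / ρ x = T x := by
    rw [he_s, mul_div_cancel_left₀ _ (hρpos x).ne']
  have hone (x : R3) : e_s x / (ρ x * T x) = 1 := by
    rw [he_s, div_self (mul_pos (hρpos x) (hTpos x)).ne']
  simp only [hTs, hone, one_smul]
  set u : R3 → R3 := fun y i => e_v y i / ρ y with hu
  set q : R3 → R3 := fun y => ((1 / T y) • K y) *ᵥ grad T y with hq
  have hev' (i : Fin 3) : ContDiff ℝ (⊤ : ℕ∞) fun y => e_v y i := contDiff_pi.1 hev i
  have hu' (i : Fin 3) : ContDiff ℝ (⊤ : ℕ∞) fun y => u y i :=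
    (hev' i).div hρ fun y => (hρpos y).ne'
  have hq' (i : Fin 3) : ContDiff ℝ (⊤ : ℕ∞) fun y => q y i :=
    contDiff_mulVec (fun i j => (contDiff_const.div hT fun y => (hTpos y).ne').mul (hK i j))
      (fun i => contDiff_pd hT i) i
  have hTq (i : Fin 3) : ContDiff ℝ (⊤ : ℕ∞) fun y => (T y • q y) i := hT.mul (hq' i)
  have hee (i : Fin 3) : ContDiff ℝ (⊤ : ℕ∞) fun y => (e_ρ y • e_v y) i := heρ.mul (hev' i)
  have hτu (i : Fin 3) : ContDiff ℝ (⊤ : ℕ∞) fun y => (τ y *ᵥ u y) i := contDiff_mulVec hτ hu' i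
  have hF (i : Fin 3) :
      ContDiff ℝ (⊤ : ℕ∞) fun y => (T y • q y - e_ρ y • e_v y - τ y *ᵥ u y) i :=
    ((hTq i).sub (hee i)).sub (hτu i)
  have hFs (i : Fin 3) :
      HasCompactSupport fun y => (T y • q y - e_ρ y • e_v y - τ y *ᵥ u y) i := by
    refine HasCompactSupport.intro' (hgradT.isCompact.union hevsupp.isCompact)
      ((isClosed_tsupport _).union (isClosed_tsupport _)) fun x hx => ?_
    have h1 : grad T x = 0 := image_eq_zero_of_notMem_tsupport fun h => hx (Or.inl h)
    have h2 : e_v x = 0 := image_eq_zero_of_notMem_tsupport fun h => hx (Or.inr h)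
    have h3 : u x = 0 := by
      funext j
      simp [hu, h2]
    simp [hq, h1, h2, h3]
  rw [← integral_vdiv_eq_zero hF hFs]
  congr 1 with x
  have diff {f : R3 → ℝ} (hf : ContDiff ℝ (⊤ : ℕ∞) f) : DifferentiableAt ℝ f x :=
    hf.differentiable (by simp) x
  rw [vdiv_sub (u := fun y => T y • q y - e_ρ y • e_v y) (fun i => diff ((hTq i).sub (hee i)))
    fun i => diff (hτu i), vdiv_sub (fun i => diff (hTq i)) fun i => diff (hee i),
    vdiv_smul (diff hT) fun i => diff (hq' i), vdiv_smul (diff heρ) fun i => diff (hev' i),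
    vdiv_mulVec (fun i j => diff (hτ i j)) fun i => diff (hu' i), (hτsym x).eq]
  have hcross := dotProduct_cross_self (ω x) (e_v x)
  have hqx : ((1 / T x) • K x) *ᵥ grad T x = q x := rfl
  have hux (i : Fin 3) : u x i = e_v x i / ρ x := rfl
  have hρx := (hρpos x).ne'
  have hTx := (hTpos x).ne'
  rw [hqx, he_s]
  generalize cross (ω x) (e_v x) = c at *
  generalize q x = qx at *
  simp only [dotProduct, Fin.sum_univ_three, hux] at hcross ⊢
  field_simp
  linear_combination (-1) * hcross
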